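/- Let a, b ∈ ℝ² be linearly independent over ℝ, let r, s ∈ ℝ, and set ν = r·a + s·b. If the real numbers 1, r, s are linearly independent over ℚ, then the forward semigroup {ℓ + n·ν : ℓ ∈ ℤ·a + ℤ·b, n ∈ ℕ} is dense in ℝ². -/

import Mathlib

open Filter Topology in
/-- A subgroup accumulating at `0` has a line in its closure. -/
lemma exists_line_closure {E : Type*} [NormedAddCommGroup E] [NormedSpace ℝ E] [ProperSpace E]
    (G : AddSubgroup E) (h0 : (0 : E) ∈ closure ((G : Set E) \ {0})) :
    ∃ u : E, ‖u‖ = 1 ∧ ∀ t : ℝ, t • u ∈ closure (G : Set E) := by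
  obtain ⟨F, hF, hF0⟩ := mem_closure_iff_ultrafilter.1 h0
  have hG : ∀ᶠ x in (F : Filter E), x ∈ G := by
    filter_upwards [hF] with x hx using hx.1
  have hne : ∀ᶠ x in (F : Filter E), x ≠ 0 := by
    filter_upwards [hF] with x hx using hx.2
  obtain ⟨u, hu, hlim⟩ := (isCompact_sphere (0 : E) 1).ultrafilter_le_nhds
    (F.map (fun x => ‖x‖⁻¹ • x)) (by
      rw [le_principal_iff]
      change ∀ᶠ x in (F : Filter E), ‖x‖⁻¹ • x ∈ Metric.sphere (0 : E) 1
      filter_upwards [hne] with x hx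
      simp [norm_smul, norm_ne_zero_iff.2 hx])
  have hlim' : Tendsto (fun x : E => ‖x‖⁻¹ • x) F (𝓝 u) := hlim
  refine ⟨u, by simpa using hu, fun t => ?_⟩
  have hn : Tendsto (fun x : E => ‖x‖) F (𝓝 0) := by
    have : Tendsto (fun x : E => ‖x‖) (𝓝 0) (𝓝 ‖(0 : E)‖) := continuous_norm.tendsto 0
    rw [norm_zero] at this
    exact this.mono_left hF0
  have hfl : Tendsto (fun x : E => (⌊t / ‖x‖⌋ : ℝ) * ‖x‖) F (𝓝 t) := by
    have hl : Tendsto (fun x : E => t - ‖x‖) F (𝓝 t) := by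
      simpa using tendsto_const_nhds.sub hn
    refine tendsto_of_tendsto_of_tendsto_of_le_of_le' hl tendsto_const_nhds ?_ ?_
    · filter_upwards [hne] with x hx
      have hp : 0 < ‖x‖ := norm_pos_iff.2 hx
      have h1 := (Int.lt_floor_add_one (t / ‖x‖)).le
      rw [div_le_iff₀ hp] at h1
      linarith
    · filter_upwards [hne] with x hx
      have hp : 0 < ‖x‖ := norm_pos_iff.2 hx
      exact (le_div_iff₀ hp).1 (Int.floor_le (t / ‖x‖))
  refine mem_closure_of_tendsto (hfl.smul hlim') ?_
  filter_upwards [hG, hne] with x hx hx0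
  have : ((⌊t / ‖x‖⌋ : ℝ) * ‖x‖) • ‖x‖⁻¹ • x = ⌊t / ‖x‖⌋ • x := by
    rw [smul_smul, mul_assoc, mul_inv_cancel₀ (norm_ne_zero_iff.2 hx0), mul_one,
      Int.cast_smul_eq_zsmul]
  rw [this]
  exact G.zsmul_mem hx _

/-- Simultaneous approximation with arbitrarily large multipliers. -/
lemma exists_large_approx (r s ε : ℝ) (hε : 0 < ε) (N : ℕ) :
    ∃ k : ℕ, N ≤ k ∧ ∃ m n : ℤ, |k * r - m| < ε ∧ |k * s - n| < ε := by
  have h := mapClusterPt_zero_atTop_nsmul ((r : UnitAddCircle), (s : UnitAddCircle))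
  have h2 := (mapClusterPt_iff_frequently.1 h) _ (Metric.ball_mem_nhds _ hε)
  obtain ⟨k, hk, hb⟩ := (Filter.frequently_atTop.1 h2) N
  refine ⟨k, hk, round (k * r), round (k * s), ?_⟩
  rw [mem_ball_zero_iff, Prod.norm_def, max_lt_iff] at hb
  obtain ⟨h1, h2⟩ := hb
  constructor
  · rw [← UnitAddCircle.norm_eq]
    simpa using h1
  · rw [← UnitAddCircle.norm_eq]
    simpa using h2

/-- The group `ℤ² + ℤ (r, s)`. -/
def latGroup (r s : ℝ) : AddSubgroup (ℝ × ℝ) where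
  carrier := {p | ∃ m n k : ℤ, p = (m + k * r, n + k * s)}
  zero_mem' := ⟨0, 0, 0, by ext <;> simp⟩
  add_mem' := by
    rintro _ _ ⟨m, n, k, rfl⟩ ⟨m', n', k', rfl⟩
    refine ⟨m + m', n + n', k + k', ?_⟩
    ext <;> simp <;> ring
  neg_mem' := by
    rintro _ ⟨m, n, k, rfl⟩
    refine ⟨-m, -n, -k, ?_⟩
    ext <;> simp <;> ring

lemma int_rel {r s : ℝ} (hrat : LinearIndependent ℚ ![(1 : ℝ), r, s]) (x y z : ℤ)
    (h : (x : ℝ) + y * r + z * s = 0) : x = 0 ∧ y = 0 ∧ z = 0 := by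
  have := Fintype.linearIndependent_iff.1 hrat ![(x : ℚ), y, z]
    (by simpa [Fin.sum_univ_three, Rat.smul_def] using h)
  exact ⟨by simpa using this 0, by simpa using this 1, by simpa using this 2⟩

lemma latGroup_dense {r s : ℝ} (hrat : LinearIndependent ℚ ![(1 : ℝ), r, s]) :
    Dense (latGroup r s : Set (ℝ × ℝ)) := by
  have h0 : (0 : ℝ × ℝ) ∈ closure ((latGroup r s : Set (ℝ × ℝ)) \ {0}) := by
    rw [Metric.mem_closure_iff]
    intro ε hε
    obtain ⟨k, hk, m, n, h1, h2⟩ := exists_large_approx r s ε hε 1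
    refine ⟨(-m + k * r, -n + k * s), ⟨⟨-m, -n, k, by simp⟩, ?_⟩, ?_⟩
    · intro h
      have h3 : -(m : ℝ) + k * r = 0 := congrArg Prod.fst h
      have := int_rel hrat (-m) k 0 (by simpa using h3)
      omega
    · rw [dist_zero_left, Prod.norm_def, max_lt_iff]
      constructor
      · simpa [neg_add_eq_sub] using h1
      · simpa [neg_add_eq_sub] using h2
  obtain ⟨u, hu, hline⟩ := exists_line_closure _ h0
  let φ : ℝ × ℝ →ₗ[ℝ] ℝ := u.2 • LinearMap.fst ℝ ℝ ℝ - u.1 • LinearMap.snd ℝ ℝ ℝ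
  have hφ : ∀ p, φ p = u.2 * p.1 - u.1 * p.2 := fun p => by simp [φ]
  have hu0 : 0 < u.1 ^ 2 + u.2 ^ 2 := by
    by_contra hcon
    have h1 : u.1 = 0 := by nlinarith [sq_nonneg u.1, sq_nonneg u.2]
    have h2 : u.2 = 0 := by nlinarith [sq_nonneg u.1, sq_nonneg u.2]
    have : u = 0 := Prod.ext h1 h2
    simp [this] at hu
  have hsurj : Function.Surjective φ := by
    intro c
    refine ⟨(c / (u.1 ^ 2 + u.2 ^ 2)) • (u.2, -u.1), ?_⟩
    rw [hφ]
    simp only [Prod.smul_mk, smul_eq_mul]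
    field_simp
    ring
  have hd : Dense ((latGroup r s).map φ.toAddMonoidHom : Set ℝ) := by
    rcases AddSubgroup.dense_or_cyclic ((latGroup r s).map φ.toAddMonoidHom) with h | ⟨c, hc⟩
    · exact h
    exfalso
    have key : ∀ p ∈ latGroup r s, ∃ j : ℤ, (j : ℝ) * c = φ p := by
      intro p hp
      have : φ p ∈ (latGroup r s).map φ.toAddMonoidHom := ⟨p, hp, rfl⟩
      rw [hc, AddSubgroup.mem_closure_singleton] at this
      obtain ⟨j, hj⟩ := this
      exact ⟨j, by simpa using hj⟩
    obtain ⟨j1, h1⟩ := key (1, 0) ⟨1, 0, 0, by simp⟩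
    obtain ⟨j2, h2⟩ := key (0, 1) ⟨0, 1, 0, by simp⟩
    obtain ⟨j3, h3⟩ := key (r, s) ⟨0, 0, 1, by simp⟩
    simp only [hφ, mul_one, mul_zero, sub_zero, zero_sub] at h1 h2 h3
    have hc0 : c ≠ 0 := by
      rintro rfl
      simp only [mul_zero] at h1 h2
      have : u.1 = 0 := by linarith
      rw [← h1, this] at hu0
      simp at hu0
    have hrel : ((-j3 : ℤ) : ℝ) + j1 * r + j2 * s = 0 := by
      apply mul_right_cancel₀ hc0
      push_cast
      linear_combination r * h1 + s * h2 - h3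
    obtain ⟨_, e1, e2⟩ := int_rel hrat _ _ _ hrel
    rw [e1] at h1
    rw [e2] at h2
    simp only [Int.cast_zero, zero_mul] at h1 h2
    have : u.1 = 0 := by linarith
    rw [← h1, this] at hu0
    simp at hu0
  have hpre := hd.preimage (φ.isOpenMap_of_finiteDimensional hsurj)
  rw [← dense_closure]
  refine hpre.mono ?_
  rintro p ⟨g, hg, hgp⟩
  have hgp' : φ g = φ p := hgp
  rw [hφ, hφ] at hgp'
  have hp : p = g + (((p.1 - g.1) * u.1 + (p.2 - g.2) * u.2) / (u.1 ^ 2 + u.2 ^ 2)) • u := by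
    ext
    · simp only [Prod.fst_add, Prod.smul_fst, smul_eq_mul]
      field_simp
      linear_combination (-u.2) * hgp'
    · simp only [Prod.snd_add, Prod.smul_snd, smul_eq_mul]
      field_simp
      linear_combination u.1 * hgp'
  rw [hp]
  have := (latGroup r s).topologicalClosure.add_mem
    ((latGroup r s).le_topologicalClosure hg)
    (hline (((p.1 - g.1) * u.1 + (p.2 - g.2) * u.2) / (u.1 ^ 2 + u.2 ^ 2)))
  exact this

lemma forward_dense {r s : ℝ} (hrat : LinearIndependent ℚ ![(1 : ℝ), r, s]) :
    Dense {p : ℝ × ℝ | ∃ m n : ℤ, ∃ k : ℕ, p = (m + k * r, n + k * s)} := by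
  rw [Metric.dense_iff]
  intro x ε hε
  obtain ⟨g, hgb, m, n, k, rfl⟩ := Metric.dense_iff.1 (latGroup_dense hrat) x (ε / 2) (half_pos hε)
  obtain ⟨K, hK, m', n', h1, h2⟩ := exists_large_approx r s (ε / 2) (half_pos hε) k.natAbs
  have hk : ((k + K).toNat : ℝ) = k + K := by
    have : ((k + K).toNat : ℤ) = k + K := Int.toNat_of_nonneg (by omega)
    exact_mod_cast this
  refine ⟨((m - m' : ℤ) + ((k + K).toNat : ℝ) * r, (n - n' : ℤ) + ((k + K).toNat : ℝ) * s), ?_,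
    m - m', n - n', (k + K).toNat, rfl⟩
  rw [hk]
  rw [mem_ball_iff_norm, Prod.norm_def, max_lt_iff] at hgb ⊢
  simp only [Prod.fst_sub, Prod.snd_sub, Real.norm_eq_abs, abs_lt, Int.cast_sub] at *
  refine ⟨⟨?_, ?_⟩, ?_, ?_⟩ <;> linarith [hgb.1.1, hgb.1.2, hgb.2.1, hgb.2.2]

/-- **Density of the forward semigroup.** If `a, b ∈ ℝ²` are linearly independent,
`ν = r•a + s•b`, and `1, r, s` are linearly independent over `ℚ`, then the forward semigroup
`{ℓ + n·ν : ℓ ∈ ℤ·a + ℤ·b, n ∈ ℕ}` is dense in `ℝ²`. -/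
theorem dense_forward_semigroup (a b : ℝ × ℝ) (hab : LinearIndependent ℝ ![a, b])
    (r s : ℝ) (ν : ℝ × ℝ) (hν : ν = r • a + s • b)
    (hrat : LinearIndependent ℚ ![(1 : ℝ), r, s]) :
    Dense {p : ℝ × ℝ | ∃ m n : ℤ, ∃ k : ℕ,
      p = (m : ℝ) • a + (n : ℝ) • b + (k : ℝ) • ν} := by
  let f : ℝ × ℝ → ℝ × ℝ := fun x => x.1 • a + x.2 • b
  have hf : Continuous f := by fun_prop
  have hsurj : Function.Surjective f := by
    intro y
    have hs := hab.span_eq_top_of_card_eq_finrank (by simp)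
    have hy : y ∈ Submodule.span ℝ (Set.range ![a, b]) := by rw [hs]; trivial
    rw [Matrix.range_cons, Matrix.range_cons, Matrix.range_empty, Set.union_empty,
      Set.singleton_union, Submodule.mem_span_pair] at hy
    obtain ⟨c, d, h⟩ := hy
    exact ⟨(c, d), h⟩
  refine (hsurj.denseRange.dense_image hf (forward_dense hrat)).mono ?_
  rintro _ ⟨_, ⟨m, n, k, rfl⟩, rfl⟩
  refine ⟨m, n, k, ?_⟩
  rw [hν]
  simp only [f]
  module
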